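/- Under the elimination-data hypotheses, the first Baues–Wirsching cohomology H¹_BW(C, D̂∘t) is isomorphic as a k-vector space to the quotient (⊕_{α arrow of Q} D̂(t(α))) / (V̄ + W̄). -/

import Mathlib

/-- Paths in a quiver given by source and target maps `s t : E → P`.
`QPath s t x y` is the type of paths from `x` to `y`. -/
inductive QPath {P E : Type} (s t : E → P) : P → P → Type
  | nil (x : P) : QPath s t x x
  | cons {x : P} (e : E) (p : QPath s t x (s e)) : QPath s t x (t e)

namespace QPath

variable {P E : Type} {s t : E → P}

/-- Concatenation of paths. -/
def comp : ∀ {x y z : P}, QPath s t x y → QPath s t y z → QPath s t x z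
  | _, _, _, p, .nil _ => p
  | _, _, _, p, .cons e q => .cons e (comp p q)

/-- The length-one path given by a single arrow. -/
def single (e : E) : QPath s t (s e) (t e) := .cons e (.nil (s e))

/-- The length of a path. -/
def length : ∀ {x y : P}, QPath s t x y → ℕ
  | _, _, .nil _ => 0
  | _, _, .cons _ p => length p + 1

/-- The list of arrows occurring in a path. -/
def arrows : ∀ {x y : P}, QPath s t x y → List E
  | _, _, .nil _ => []
  | _, _, .cons e p => e :: arrows p

end QPath

section BW

variable (k : Type) [Field k] {P E : Type} (s t : E → P)
  (D : P → Type) [∀ x, AddCommGroup (D x)] [∀ x, Module k (D x)]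
  (De : ∀ e : E, D (s e) →ₗ[k] D (t e))

/-- The value of a functor (given on vertices by `D` and on arrows by `De`)
on a path, i.e. the composite of the linear maps along the path. -/
def pathMap : ∀ {x y : P}, QPath s t x y → (D x →ₗ[k] D y)
  | _, _, .nil _ => LinearMap.id
  | _, _, .cons e p => (De e).comp (pathMap p)

/-- `d` is a derivation with coefficients in the natural system `D̂ ∘ t`:
`d (q ∘ p) = D̂(q) (d p) + d q`. -/
def IsDerivation (d : ∀ x y : P, QPath s t x y → D y) : Prop :=
  ∀ (x y z : P) (p : QPath s t x y) (q : QPath s t y z),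
    d x z (p.comp q) = pathMap k s t D De q (d x y p) + d y z q

/-- The space of derivations. -/
def Der : Submodule k (∀ x y : P, QPath s t x y → D y) where
  carrier := {d | IsDerivation k s t D De d}
  add_mem' := by
    intro a b ha hb x y z p q
    simp only [Pi.add_apply, ha x y z p q, hb x y z p q, map_add]
    abel
  zero_mem' := by
    intro x y z p q
    simp
  smul_mem' := by
    intro c a ha x y z p q
    simp only [Pi.smul_apply, ha x y z p q, map_smul, smul_add]

/-- The space of inner derivations. -/
def Ider : Submodule k (∀ x y : P, QPath s t x y → D y) where
  carrier := {d | ∃ nn : ∀ x : P, D x, ∀ (x y : P) (p : QPath s t x y),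
    d x y p = pathMap k s t D De p (nn x) - nn y}
  add_mem' := by
    rintro a b ⟨na, hna⟩ ⟨nb, hnb⟩
    refine ⟨na + nb, fun x y p => ?_⟩
    simp only [Pi.add_apply, hna x y p, hnb x y p, map_add]
    abel
  zero_mem' := ⟨0, fun x y p => by simp⟩
  smul_mem' := by
    rintro c a ⟨na, hna⟩
    refine ⟨c • na, fun x y p => ?_⟩
    simp only [Pi.smul_apply, hna x y p, map_smul, smul_sub]

/-- Inner derivations, as a submodule of the space of derivations. -/
def IderInDer : Submodule k ↥(Der k s t D De) :=
  (Ider k s t D De).comap (Der k s t D De).subtype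

/-- The first Baues–Wirsching cohomology `Der/IDer`. -/
abbrev BW1 := ↥(Der k s t D De) ⧸ IderInDer k s t D De

/-- The restriction map `ρ` sending a derivation to its values on the arrows. -/
def restrict : ↥(Der k s t D De) →ₗ[k] (∀ e : E, D (t e)) where
  toFun d := fun e => (d : ∀ x y : P, QPath s t x y → D y) (s e) (t e) (QPath.single e)
  map_add' a b := rfl
  map_smul' c a := rfl

end BW

section Elim

variable (k : Type) [Field k] {P E : Type} (s t : E → P)
  (D : P → Type) [∀ x, AddCommGroup (D x)] [∀ x, Module k (D x)]
  (De : ∀ e : E, D (s e) →ₗ[k] D (t e))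
  {l m n r : ℕ}

/-- A path is a `Q1`-path if all of its arrows belong to the range of `f`. -/
def IsQ1 (f : Fin l → E) {x y : P} (p : QPath s t x y) : Prop :=
  ∀ e ∈ p.arrows, ∃ i, f i = e

open scoped Classical in
/-- The component at an arrow `e` (not in `Q1`) of the vectors `V_j(v)` and `W_j(v)`:
`D̂(p)(v) − D̂(e ∘ p')(v)` where `p` (resp. `p'`) is a `Q1`-path from `x` to `t e`
(resp. to `s e`), a missing term being `0`. -/
noncomputable def pathTerm (f : Fin l → E) (x : P) (e : E) (v : D x) : D (t e) :=
  (if hp : ∃ p : QPath s t x (t e), IsQ1 s t f p then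
      pathMap k s t D De hp.choose v
    else 0)
  - (if hp : ∃ p : QPath s t x (s e), IsQ1 s t f p then
      De e (pathMap k s t D De hp.choose v)
    else 0)

open scoped Classical in
/-- The vector `V_j(v)`. -/
noncomputable def Vvec (a : Fin l → P) (f : Fin l → E) (hft : ∀ i, t (f i) = a i)
    (j : Fin l) (v : D (a j)) : ∀ e : E, D (t e) := fun e =>
  if ∃ i, f i = e then
    (if he : f j = e then cast (show D (a j) = D (t e) by rw [← he, hft j]) v else 0)
  else pathTerm k s t D De f (a j) e v

open scoped Classical in
/-- The vector `W_j(v)`. -/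
noncomputable def Wvec (b : Fin m → P) (f : Fin l → E)
    (j : Fin m) (v : D (b j)) : ∀ e : E, D (t e) := fun e =>
  if ∃ i, f i = e then 0 else pathTerm k s t D De f (b j) e v

end Elim

namespace QPath

variable {P E : Type} {s t : E → P}

/-- A path is either trivial or ends with an arrow. -/
theorem eq_nil_or_eq_cons {x y : P} (p : QPath s t x y) :
    (∃ h : x = y, p = h ▸ QPath.nil x) ∨
      ∃ (e : E) (h : t e = y) (q : QPath s t x (s e)), p = h ▸ QPath.cons e q := by
  cases p with
  | nil => exact Or.inl ⟨rfl, rfl⟩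
  | cons e q => exact Or.inr ⟨e, rfl, q, rfl⟩

end QPath

section Derivations

variable (k : Type) [Field k] {P E : Type} (s t : E → P)
  (D : P → Type) [∀ x, AddCommGroup (D x)] [∀ x, Module k (D x)]
  (De : ∀ e : E, D (s e) →ₗ[k] D (t e))

theorem pathMap_comp {x y z : P} (p : QPath s t x y) (q : QPath s t y z) (v : D x) :
    pathMap k s t D De (p.comp q) v = pathMap k s t D De q (pathMap k s t D De p v) := by
  induction q with
  | nil => simp [QPath.comp, pathMap]
  | cons e q ih => simp only [QPath.comp, pathMap, LinearMap.comp_apply, ih]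

/-- The extension to all paths of a family of values on the arrows. -/
def extendToPaths (w : ∀ e : E, D (t e)) : ∀ x y : P, QPath s t x y → D y
  | _, _, .nil _ => 0
  | _, _, .cons e p => De e (extendToPaths w _ _ p) + w e

theorem extendToPaths_mem_der (w : ∀ e : E, D (t e)) :
    extendToPaths k s t D De w ∈ Der k s t D De := by
  intro x y z p q
  induction q with
  | nil => simp [QPath.comp, pathMap, extendToPaths]
  | cons e q ih =>
    simp only [QPath.comp, pathMap, extendToPaths, ih, map_add, LinearMap.comp_apply]
    abel

theorem der_apply_nil (d : Der k s t D De) (x : P) : d.1 x x (.nil x) = 0 := by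
  have h := d.2 x x x (.nil x) (.nil x)
  simpa [QPath.comp, pathMap] using h

theorem der_apply_cons (d : Der k s t D De) {x : P} (e : E) (p : QPath s t x (s e)) :
    d.1 x (t e) (.cons e p) = De e (d.1 x (s e) p) + restrict k s t D De d e := by
  simpa [restrict, QPath.single, QPath.comp, pathMap]
    using d.2 x (s e) (t e) p (QPath.single e)

theorem restrict_bijective : Function.Bijective (restrict k s t D De) := by
  constructor
  · rw [injective_iff_map_eq_zero]
    intro d hd
    ext x y p
    change d.1 x y p = 0
    induction p with
    | nil => exact der_apply_nil k s t D De d _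
    | cons e p ih => rw [der_apply_cons, ih, hd]; simp
  · intro w
    refine ⟨⟨_, extendToPaths_mem_der k s t D De w⟩, ?_⟩
    ext e
    simp [restrict, QPath.single, extendToPaths]

/-- The coboundary `n ↦ (n_{t e} − D̂(e)(n_{s e}))_e` of a family of vectors on the vertices. -/
def arrowCoboundary : (∀ x : P, D x) →ₗ[k] (∀ e : E, D (t e)) where
  toFun n := fun e => n (t e) - De e (n (s e))
  map_add' n n' := by
    ext e
    simp only [Pi.add_apply, map_add]
    abel
  map_smul' c n := by
    ext e
    simp [smul_sub]

theorem map_restrict_iderInDer :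
    (IderInDer k s t D De).map (restrict k s t D De)
      = LinearMap.range (arrowCoboundary k s t D De) := by
  ext w
  constructor
  · rintro ⟨d, ⟨n, hn⟩, rfl⟩
    refine ⟨-n, ?_⟩
    ext e
    refine Eq.trans ?_ (hn (s e) (t e) (QPath.single e)).symm
    simp only [arrowCoboundary, LinearMap.coe_mk, AddHom.coe_mk, QPath.single,
      pathMap, LinearMap.comp_apply, LinearMap.id_apply, Pi.neg_apply, map_neg]
    abel
  · rintro ⟨n, rfl⟩
    let d : ∀ x y : P, QPath s t x y → D y := fun x y p => n y - pathMap k s t D De p (n x)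
    have hd : d ∈ Der k s t D De := by
      intro x y z p q
      simp only [d, pathMap_comp, map_sub]
      abel
    refine ⟨⟨d, hd⟩, ⟨-n, fun x y p => ?_⟩, ?_⟩
    · simp only [Submodule.subtype_apply, d, Pi.neg_apply, map_neg]
      abel
    · ext e
      simp [restrict, arrowCoboundary, d, QPath.single, pathMap]

end Derivations

section ForestPaths

variable (k : Type) [Field k] {P E : Type} (s t : E → P)
  (D : P → Type) [∀ x, AddCommGroup (D x)] [∀ x, Module k (D x)]
  (De : ∀ e : E, D (s e) →ₗ[k] D (t e))
  {l m : ℕ} {f : Fin l → E}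

variable {s t} in
theorem isQ1_cons {x : P} {e : E} {p : QPath s t x (s e)} :
    IsQ1 s t f (.cons e p) ↔ (∃ i, f i = e) ∧ IsQ1 s t f p := by
  simp [IsQ1, QPath.arrows]

variable {s t} in
theorem IsQ1.rank_le {rk : P → ℕ} (hrk : ∀ i, rk (s (f i)) < rk (t (f i))) {x y : P}
    {p : QPath s t x y} (hp : IsQ1 s t f p) : rk x ≤ rk y := by
  induction p with
  | nil => exact le_rfl
  | cons e p ih =>
    obtain ⟨⟨i, rfl⟩, hp⟩ := isQ1_cons.1 hp
    exact (ih hp).trans (hrk i).le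

variable {s t} in
theorem IsQ1.unique {rk : P → ℕ} (hrk : ∀ i, rk (s (f i)) < rk (t (f i)))
    (hinj : Function.Injective fun i => t (f i)) {x y : P}
    {p q : QPath s t x y} (hp : IsQ1 s t f p) (hq : IsQ1 s t f q) : p = q := by
  induction p with
  | nil =>
    obtain ⟨_, rfl⟩ | ⟨e, h, q, rfl⟩ := q.eq_nil_or_eq_cons
    · rfl
    · subst h
      obtain ⟨⟨i, rfl⟩, hq⟩ := isQ1_cons.1 hq
      exact absurd (hq.rank_le hrk) (hrk i).not_ge
  | cons e p ih =>
    obtain ⟨⟨i, rfl⟩, hp⟩ := isQ1_cons.1 hp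
    obtain ⟨h, rfl⟩ | ⟨e, h, q, rfl⟩ := q.eq_nil_or_eq_cons
    · subst h
      exact absurd (hp.rank_le hrk) (hrk i).not_ge
    · obtain ⟨j, rfl⟩ : ∃ j, f j = e := by
        revert hq
        generalize t (f i) = y at h
        subst h
        exact fun hq => (isQ1_cons.1 hq).1
      obtain rfl : j = i := hinj h
      exact congrArg _ (ih hp (isQ1_cons.1 hq).2)

open scoped Classical in
/-- The family of vectors obtained by transporting `v : D x` along the `Q1`-paths
starting at `x`. -/
noncomputable def transport (f : Fin l → E) (x : P) (v : D x) (y : P) : D y :=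
  if hp : ∃ p : QPath s t x y, IsQ1 s t f p then pathMap k s t D De hp.choose v else 0

theorem arrowCoboundary_transport (x : P) (v : D x) (e : E) :
    arrowCoboundary k s t D De (transport k s t D De f x v) e = pathTerm k s t D De f x e v := by
  simp only [arrowCoboundary, transport, pathTerm, LinearMap.coe_mk, AddHom.coe_mk]
  split_ifs <;> simp

theorem transport_eq_zero {x y : P} (h : ∀ p : QPath s t x y, ¬ IsQ1 s t f p) (v : D x) :
    transport k s t D De f x v y = 0 :=
  dif_neg (by simpa using h)

theorem transport_eq_pathMap {rk : P → ℕ} (hrk : ∀ i, rk (s (f i)) < rk (t (f i)))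
    (hinj : Function.Injective fun i => t (f i)) {x y : P}
    {p : QPath s t x y} (hp : IsQ1 s t f p) (v : D x) :
    transport k s t D De f x v y = pathMap k s t D De p v := by
  have h : ∃ p : QPath s t x y, IsQ1 s t f p := ⟨p, hp⟩
  rw [transport, dif_pos h, h.choose_spec.unique hrk hinj hp]

theorem transport_self {rk : P → ℕ} (hrk : ∀ i, rk (s (f i)) < rk (t (f i)))
    (hinj : Function.Injective fun i => t (f i)) {x y : P} (h : x = y)
    (hD : D x = D y) (v : D x) : transport k s t D De f x v y = cast hD v := by
  subst h
  rw [transport_eq_pathMap k s t D De hrk hinj (p := .nil x) (by simp [IsQ1, QPath.arrows]),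
    pathMap, LinearMap.id_apply, cast_eq]

theorem transport_of_not_mem_range {x y : P} (hxy : x ≠ y) (hy : ∀ i, t (f i) ≠ y) (v : D x) :
    transport k s t D De f x v y = 0 := by
  refine transport_eq_zero k s t D De (fun p hp => ?_) v
  obtain ⟨h, _⟩ | ⟨e, rfl, q, rfl⟩ := p.eq_nil_or_eq_cons
  · exact hxy h
  · obtain ⟨⟨i, rfl⟩, _⟩ := isQ1_cons.1 hp
    exact hy i rfl

theorem transport_source_eq_zero {rk : P → ℕ} (hrk : ∀ i, rk (s (f i)) < rk (t (f i)))
    (i : Fin l) (v : D (t (f i))) : transport k s t D De f (t (f i)) v (s (f i)) = 0 :=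
  transport_eq_zero k s t D De (fun _ hp => (hrk i).not_ge (hp.rank_le hrk)) v

theorem transport_target {rk : P → ℕ} (hrk : ∀ i, rk (s (f i)) < rk (t (f i)))
    (hinj : Function.Injective fun i => t (f i)) {x : P} (i : Fin l)
    (hx : x ≠ t (f i)) (v : D x) :
    transport k s t D De f x v (t (f i)) = De (f i) (transport k s t D De f x v (s (f i))) := by
  by_cases h : ∃ p : QPath s t x (s (f i)), IsQ1 s t f p
  · obtain ⟨p, hp⟩ := h
    rw [transport_eq_pathMap k s t D De hrk hinj hp,
      transport_eq_pathMap k s t D De hrk hinj (isQ1_cons.2 ⟨⟨i, rfl⟩, hp⟩),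
      pathMap, LinearMap.comp_apply]
  · rw [transport_eq_zero k s t D De (y := s (f i)) (fun p hp => h ⟨p, hp⟩), map_zero]
    refine transport_eq_zero k s t D De (fun p hp => ?_) v
    obtain ⟨h', _⟩ | ⟨e, he, q, rfl⟩ := p.eq_nil_or_eq_cons
    · exact hx h'
    · have hq : (∃ j, f j = e) ∧ IsQ1 s t f q := by
        revert hp
        generalize t (f i) = y at he
        subst he
        exact isQ1_cons.1
      obtain ⟨⟨j, rfl⟩, hq⟩ := hq
      obtain rfl : j = i := hinj he
      exact h ⟨q, hq⟩

/-- Every family of vectors on the vertices is a sum of transported vectors. -/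
theorem exists_eq_sum_transport [Fintype P] {rk : P → ℕ} (hrk : ∀ i, rk (s (f i)) < rk (t (f i)))
    (hinj : Function.Injective fun i => t (f i)) (n : ∀ x : P, D x) :
    ∃ u : ∀ x : P, D x, n = ∑ x, transport k s t D De f x (u x) := by
  classical
  have hu : ∃ u : ∀ x : P, D x,
      (∀ i, u (t (f i)) = n (t (f i)) - De (f i) (n (s (f i)))) ∧
      ∀ y, (∀ i, t (f i) ≠ y) → u y = n y := by
    have hy : ∀ y, ∃ w : D y, (∀ i, ∀ h : t (f i) = y,
        w = h ▸ (n (t (f i)) - De (f i) (n (s (f i))))) ∧ ((∀ i, t (f i) ≠ y) → w = n y) := by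
      intro y
      by_cases h : ∃ i, t (f i) = y
      · obtain ⟨i, rfl⟩ := h
        refine ⟨n (t (f i)) - De (f i) (n (s (f i))), fun j h => ?_, fun h => absurd rfl (h i)⟩
        obtain rfl : j = i := hinj h
        rfl
      · exact ⟨n y, fun i hi => absurd ⟨i, hi⟩ h, fun _ => rfl⟩
    choose u hu using hy
    exact ⟨u, fun i => (hu _).1 i rfl, fun y => (hu y).2⟩
  obtain ⟨u, hu, hu'⟩ := hu
  refine ⟨u, funext fun y => ?_⟩
  rw [Finset.sum_apply]
  induction hN : rk y using Nat.strong_induction_on generalizing y with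
  | _ N ih =>
    subst hN
    rw [← Finset.add_sum_erase _ _ (Finset.mem_univ y),
      transport_self k s t D De hrk hinj rfl rfl, cast_eq]
    by_cases h : ∃ i, t (f i) = y
    · obtain ⟨i, rfl⟩ := h
      rw [Finset.sum_congr rfl fun x hx =>
          transport_target k s t D De hrk hinj i (Finset.ne_of_mem_erase hx) (u x),
        ← map_sum, hu]
      have hs := ih _ (hrk i) _ rfl
      rw [← Finset.add_sum_erase _ _ (Finset.mem_univ (t (f i))),
        transport_source_eq_zero k s t D De hrk, zero_add] at hs
      rw [← hs, sub_add_cancel]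
    · push Not at h
      rw [hu' y h, Finset.sum_eq_zero fun x hx => transport_of_not_mem_range k s t D De
        (Finset.ne_of_mem_erase hx) h (u x), add_zero]

theorem vvec_eq_arrowCoboundary {rk : P → ℕ} (hrk : ∀ i, rk (s (f i)) < rk (t (f i)))
    (hinj : Function.Injective fun i => t (f i)) {a : Fin l → P} (hft : ∀ i, t (f i) = a i)
    (j : Fin l) (v : D (a j)) :
    Vvec k s t D De a f hft j v
      = arrowCoboundary k s t D De (transport k s t D De f (a j) v) := by
  ext e
  rw [Vvec]
  split_ifs with h he
  · subst he
    have hz := transport_source_eq_zero k s t D De hrk j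
    rw [hft j] at hz
    simp only [arrowCoboundary, LinearMap.coe_mk, AddHom.coe_mk]
    rw [hz, map_zero, sub_zero, transport_self k s t D De hrk hinj (hft j).symm]
  · obtain ⟨i, rfl⟩ := h
    simp only [arrowCoboundary, LinearMap.coe_mk, AddHom.coe_mk]
    rw [transport_target k s t D De hrk hinj i, sub_self]
    rw [← hft j]
    exact fun h => he (congrArg f (hinj h))
  · exact (arrowCoboundary_transport k s t D De (a j) v e).symm

theorem wvec_eq_arrowCoboundary {rk : P → ℕ} (hrk : ∀ i, rk (s (f i)) < rk (t (f i)))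
    (hinj : Function.Injective fun i => t (f i)) {b : Fin m → P} (j : Fin m)
    (hb : ∀ i, b j ≠ t (f i)) (v : D (b j)) :
    Wvec k s t D De b f j v
      = arrowCoboundary k s t D De (transport k s t D De f (b j) v) := by
  ext e
  rw [Wvec]
  split_ifs with h
  · obtain ⟨i, rfl⟩ := h
    simp only [arrowCoboundary, LinearMap.coe_mk, AddHom.coe_mk]
    rw [transport_target k s t D De hrk hinj i (hb i), sub_self]
  · exact (arrowCoboundary_transport k s t D De (b j) v e).symm

end ForestPaths

/-- under the elimination-data hypotheses, the first Baues–Wirsching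
cohomology is isomorphic to `(⊕_α D̂(t α)) / (V̄ + W̄)`. -/
theorem statement4 (k : Type) [Field k] {P E : Type} [Fintype P] [Fintype E]
    (s t : E → P)
    (D : P → Type) [∀ x, AddCommGroup (D x)] [∀ x, Module k (D x)]
    (De : ∀ e : E, D (s e) →ₗ[k] D (t e))
    {l m n r : ℕ} (a : Fin l → P) (b : Fin m → P)
    (f : Fin l → E) (g : Fin n → E) (h : Fin r → E)
    (hab : Function.Bijective (Sum.elim a b))
    (hfgh : Function.Bijective (Sum.elim f (Sum.elim g h)))
    (hft : ∀ i, t (f i) = a i)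
    (hfs : ∀ (i j : Fin l), s (f i) = a j → (i : ℕ) < (j : ℕ)) :
    Nonempty (BW1 k s t D De ≃ₗ[k]
      ((∀ e : E, D (t e)) ⧸
        (Submodule.span k
          {w : ∀ e : E, D (t e) | ∃ (j : Fin l) (v : D (a j)), w = Vvec k s t D De a f hft j v}
        + Submodule.span k
          {w : ∀ e : E, D (t e) | ∃ (j : Fin m) (v : D (b j)), w = Wvec k s t D De b f j v}))) := by
  classical
  have ha : Function.Injective a := fun i j hij => Sum.inl_injective (hab.1 hij)
  have hba : ∀ j i, b j ≠ a i := fun j i hij => by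
    simpa using hab.1 (a₁ := .inr j) (a₂ := .inl i) hij
  have hinj : Function.Injective fun i => t (f i) := by simpa only [hft] using ha
  obtain ⟨rk, hrk⟩ : ∃ rk : P → ℕ, ∀ i, rk (s (f i)) < rk (t (f i)) := by
    let e := Equiv.ofBijective _ hab
    refine ⟨fun y => Sum.elim (fun i : Fin l => l - i) (fun _ => 0) (e.symm y), fun i => ?_⟩
    have hti : e.symm (t (f i)) = .inl i := by
      rw [Equiv.symm_apply_eq, hft]
      rfl
    obtain ⟨c, hc⟩ := e.surjective (s (f i))
    simp only [hti, ← hc, Equiv.symm_apply_apply]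
    cases c with
    | inl j =>
      have := hfs i j hc.symm
      simp only [Sum.elim_inl]
      omega
    | inr j =>
      simp only [Sum.elim_inl, Sum.elim_inr]
      omega
  refine ⟨Submodule.Quotient.equiv _ _
    (LinearEquiv.ofBijective _ (restrict_bijective k s t D De)) ?_⟩
  refine (map_restrict_iderInDer k s t D De).trans (le_antisymm ?_ ?_)
  · rintro _ ⟨w, rfl⟩
    obtain ⟨u, rfl⟩ := exists_eq_sum_transport k s t D De hrk hinj w
    rw [map_sum]
    refine Submodule.sum_mem _ fun x _ => ?_
    obtain ⟨j | j, rfl⟩ := hab.2 x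
    · exact Submodule.mem_sup_left (Submodule.subset_span
        ⟨j, u (a j), (vvec_eq_arrowCoboundary k s t D De hrk hinj hft j _).symm⟩)
    · exact Submodule.mem_sup_right (Submodule.subset_span
        ⟨j, u (b j), (wvec_eq_arrowCoboundary k s t D De hrk hinj j
          (fun i => hft i ▸ hba j i) _).symm⟩)
  · refine sup_le (Submodule.span_le.2 ?_) (Submodule.span_le.2 ?_)
    · rintro _ ⟨j, v, rfl⟩
      exact ⟨_, (vvec_eq_arrowCoboundary k s t D De hrk hinj hft j v).symm⟩
    · rintro _ ⟨j, v, rfl⟩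
      exact ⟨_, (wvec_eq_arrowCoboundary k s t D De hrk hinj j (fun i => hft i ▸ hba j i) v).symm⟩
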